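/- Assume ρ̂ = ρ + αλ_min − ζ̃_{L*−K} ≥ 0, D_K is not the zero map, the mismatch assumption on (K_n) holds, and the set {x ∈ H : 0 ∈ A x + C x + D_K x} is nonempty. Let ε ∈ (0, χ/2), let (γ_n) be a sequence in [ε, χ − ε], let z₀ ∈ H, and define for every n ∈ ℕ: u_n = D_{K_n} z_n, y_n = z_n − γ_n(C z_n + u_n), x_n = J_{γ_n A}(y_n), z_{n+1} = x_n + γ_n(u_n − D_{K_n} x_n). Then (z_n) converges weakly to some z̄ ∈ H with 0 ∈ A z̄ + C z̄ + D_K z̄. -/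

import Mathlib

open Filter Topology
open scoped RealInnerProductSpace Pointwise

noncomputable section

variable {H G : Type*}

/-- A set-valued operator `A` is `ρ`-monotone. -/
def IsMonotoneSV [NormedAddCommGroup H] [InnerProductSpace ℝ H]
    (ρ : ℝ) (A : H → Set H) : Prop :=
  ∀ x y u v, u ∈ A x → v ∈ A y → ρ * ‖x - y‖ ^ 2 ≤ ⟪x - y, u - v⟫

/-- `A` is maximally `ρ`-monotone: it is `ρ`-monotone and its graph is maximal, under
inclusion, among graphs of `ρ`-monotone operators. -/
def IsMaxMonotoneSV [NormedAddCommGroup H] [InnerProductSpace ℝ H]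
    (ρ : ℝ) (A : H → Set H) : Prop :=
  IsMonotoneSV ρ A ∧
    ∀ A' : H → Set H, IsMonotoneSV ρ A' → (∀ x, A x ⊆ A' x) → ∀ x, A' x = A x

/-- `C` is `β`-cocoercive. -/
def IsCocoercive [NormedAddCommGroup H] [InnerProductSpace ℝ H]
    (β : ℝ) (C : H → H) : Prop :=
  ∀ x y, β * ‖C x - C y‖ ^ 2 ≤ ⟪x - y, C x - C y⟫

/-- `k` is a Lipschitz bound for `f`. -/
def IsLipBound {E F : Type*} [NormedAddCommGroup E] [NormedAddCommGroup F]
    (k : ℝ) (f : E → F) : Prop :=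
  ∀ x y, ‖f x - f y‖ ≤ k * ‖x - y‖

/-- `k` is the (smallest) Lipschitz constant of `f`. -/
def IsLipConst {E F : Type*} [NormedAddCommGroup E] [NormedAddCommGroup F]
    (k : ℝ) (f : E → F) : Prop :=
  IsLipBound k f ∧ ∀ k', IsLipBound k' f → k ≤ k'

/-- A single-valued map `B` is monotone. -/
def IsMonotoneMap [NormedAddCommGroup G] [InnerProductSpace ℝ G]
    (B : G → G) : Prop :=
  ∀ x y, (0:ℝ) ≤ ⟪x - y, B x - B y⟫

/-- The operator `D_M : x ↦ α M (L x - c) + M (B (L x))`. -/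
def Dop [NormedAddCommGroup H] [InnerProductSpace ℝ H]
    [NormedAddCommGroup G] [InnerProductSpace ℝ G]
    (α : ℝ) (L : H →L[ℝ] G) (c : G) (B : G → G) (M : G →L[ℝ] H) : H → H :=
  fun x => α • M (L x - c) + M (B (L x))

/-- `λ_min = inf {⟪x, K (L x)⟫ : ‖x‖ = 1}`. -/
def lambdaMin [NormedAddCommGroup H] [InnerProductSpace ℝ H]
    [NormedAddCommGroup G] [InnerProductSpace ℝ G]
    (L : H →L[ℝ] G) (K : G →L[ℝ] H) : ℝ :=
  sInf {r : ℝ | ∃ x : H, ‖x‖ = 1 ∧ r = ⟪x, K (L x)⟫}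

/-- The step-size bound `χ`. -/
def chiConst (β ρ κ : ℝ) : ℝ :=
  if 0 ≤ ρ then 4 * β / (1 + Real.sqrt (1 + 16 * β ^ 2 * κ ^ 2))
  else min (4 * β / (1 + Real.sqrt (1 + 16 * β ^ 2 * κ ^ 2))) (-1 / ρ)


section Auxiliary

variable {H G : Type*} [NormedAddCommGroup H] [InnerProductSpace ℝ H]
  [NormedAddCommGroup G] [InnerProductSpace ℝ G]

lemma IsCocoercive.norm_sub_le {β : ℝ} (hβ : 0 < β) {C : H → H} (hC : IsCocoercive β C)
    (x y : H) : ‖C x - C y‖ ≤ 1 / β * ‖x - y‖ := by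
  have h1 := hC x y
  have h2 := real_inner_le_norm (x - y) (C x - C y)
  have h3 : β * ‖C x - C y‖ ≤ ‖x - y‖ := by
    rcases (norm_nonneg (C x - C y)).eq_or_lt with h | h
    · rw [← h]; simp
    · refine le_of_mul_le_mul_right ?_ h
      nlinarith
  rw [one_div, inv_mul_eq_div, le_div_iff₀ hβ]
  linarith

lemma lambdaMin_mul_norm_sq_le (L : H →L[ℝ] G) (K : G →L[ℝ] H) (x : H) :
    lambdaMin L K * ‖x‖ ^ 2 ≤ ⟪x, K (L x)⟫ := by
  rcases eq_or_ne x 0 with rfl | hx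
  · simp
  have hn : 0 < ‖x‖ := norm_pos_iff.mpr hx
  have hbdd : BddBelow {r : ℝ | ∃ x : H, ‖x‖ = 1 ∧ r = ⟪x, K (L x)⟫} := by
    refine ⟨-‖K.comp L‖, ?_⟩
    rintro r ⟨y, hy, rfl⟩
    have h1 := abs_le.mp (abs_real_inner_le_norm y (K (L y)))
    have h2 := (K.comp L).le_opNorm y
    rw [hy] at h1 h2
    simp only [ContinuousLinearMap.comp_apply] at h2
    linarith [h1.1]
  have h := csInf_le hbdd (a := ⟪‖x‖⁻¹ • x, K (L (‖x‖⁻¹ • x))⟫)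
    ⟨‖x‖⁻¹ • x, by rw [norm_smul, norm_inv, norm_norm, inv_mul_cancel₀ hn.ne'], rfl⟩
  change lambdaMin L K ≤ _ at h
  simp only [map_smul, real_inner_smul_left, real_inner_smul_right] at h
  calc lambdaMin L K * ‖x‖ ^ 2 ≤ (‖x‖⁻¹ * (‖x‖⁻¹ * ⟪x, K (L x)⟫)) * ‖x‖ ^ 2 := by gcongr
    _ = ⟪x, K (L x)⟫ := by field_simp

lemma Dop_sub_Dop (α : ℝ) (L : H →L[ℝ] G) (c : G) (B : G → G) (M : G →L[ℝ] H) (x y : H) :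
    Dop α L c B M x - Dop α L c B M y =
      α • M (L (x - y)) + M (B (L x) - B (L y)) := by
  simp only [Dop, map_sub, smul_sub]
  abel

lemma Dop_monotone [CompleteSpace H] [CompleteSpace G] {α ζt : ℝ} (hα : 0 ≤ α)
    (L : H →L[ℝ] G) (c : G) {B : G → G} (hB : IsMonotoneMap B) (K : G →L[ℝ] H)
    (hζt : IsLipBound ζt (fun x : H => (ContinuousLinearMap.adjoint L - K) (B (L x))))
    (x y : H) :
    (α * lambdaMin L K - ζt) * ‖x - y‖ ^ 2 ≤
      ⟪x - y, Dop α L c B K x - Dop α L c B K y⟫ := by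
  rw [Dop_sub_Dop, inner_add_right, real_inner_smul_right]
  have h1 := mul_le_mul_of_nonneg_left (lambdaMin_mul_norm_sq_le L K (x - y)) hα
  have h2 : ⟪x - y, K (B (L x) - B (L y))⟫ = ⟪L x - L y, B (L x) - B (L y)⟫ -
      ⟪x - y, (ContinuousLinearMap.adjoint L - K) (B (L x)) -
        (ContinuousLinearMap.adjoint L - K) (B (L y))⟫ := by
    rw [← map_sub (ContinuousLinearMap.adjoint L - K), sub_apply,
      inner_sub_right (x - y), ContinuousLinearMap.adjoint_inner_right, map_sub L]
    ring
  have h3 := hB (L x) (L y)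
  have h4 := real_inner_le_norm (x - y) ((ContinuousLinearMap.adjoint L - K) (B (L x)) -
        (ContinuousLinearMap.adjoint L - K) (B (L y)))
  have h5 := mul_le_mul_of_nonneg_left (hζt x y) (norm_nonneg (x - y))
  simp only at h5
  nlinarith

lemma Dop_isLipBound {α κ : ℝ} (L : H →L[ℝ] G) (c : G) (B : G → G) (K : G →L[ℝ] H)
    (hκ : IsLipBound κ (fun x : H => K (α • L x + B (L x)))) :
    IsLipBound κ (Dop α L c B K) := by
  intro x y
  convert hκ x y using 2
  simp only [Dop, map_sub, map_add, map_smul, smul_sub]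
  abel

lemma Dop_perturbation {α ζ : ℝ} (hα : 0 ≤ α) (hζ : 0 ≤ ζ) (L : H →L[ℝ] G) (c : G) {B : G → G}
    (hB : IsLipBound ζ B) (K : G →L[ℝ] H) (s : H) :
    ∃ r : ℝ, 0 ≤ r ∧ ∀ (M : G →L[ℝ] H) (p : H),
      ‖Dop α L c B M p - Dop α L c B K p‖ ≤ ‖M - K‖ * (r * (1 + ‖p - s‖)) := by
  set q : H → G := fun p => α • (L p - c) + B (L p) with hq
  refine ⟨‖q s‖ + (α * ‖L‖ + ζ * ‖L‖), by positivity, fun M p => ?_⟩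
  have h1 : Dop α L c B M p - Dop α L c B K p = (M - K) (q p) := by
    simp only [Dop, hq, sub_apply, map_add, map_sub, map_smul, smul_sub]
    abel
  rw [h1]
  refine ((M - K).le_opNorm _).trans (mul_le_mul_of_nonneg_left ?_ (norm_nonneg _))
  have h2 : q p - q s = α • L (p - s) + (B (L p) - B (L s)) := by
    simp only [hq, map_sub, smul_sub]
    abel
  have h3 : ‖L (p - s)‖ ≤ ‖L‖ * ‖p - s‖ := L.le_opNorm _
  have h4 : ‖q p - q s‖ ≤ α * (‖L‖ * ‖p - s‖) + ζ * (‖L‖ * ‖p - s‖) := by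
    rw [h2]
    refine (norm_add_le _ _).trans (add_le_add ?_ ?_)
    · rw [norm_smul, Real.norm_of_nonneg hα]; gcongr
    · refine (hB _ _).trans ?_
      rw [← map_sub]; gcongr
  have h5 := norm_le_norm_add_norm_sub' (q p) (q s)
  have h6 : 0 ≤ ‖q s‖ * ‖p - s‖ := by positivity
  have h7 : 0 ≤ α * ‖L‖ + ζ * ‖L‖ := by positivity
  nlinarith

/-- The first bound in `chiConst` is the positive root of `t ↦ κ² t² + t / (2β) - 1`; staying `ε`
below it leaves a margin. -/
lemma step_bound {β κ ε γ : ℝ} (hβ : 0 < β) (hε : 0 ≤ ε) (hγ : 0 ≤ γ)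
    (h : γ ≤ 4 * β / (1 + Real.sqrt (1 + 16 * β ^ 2 * κ ^ 2)) - ε) :
    γ / (2 * β) + γ ^ 2 * κ ^ 2 + ε / (2 * β) ≤ 1 := by
  set S := Real.sqrt (1 + 16 * β ^ 2 * κ ^ 2) with hS
  have hS0 : 0 ≤ S := Real.sqrt_nonneg _
  have hS2 : S ^ 2 = 1 + 16 * β ^ 2 * κ ^ 2 := Real.sq_sqrt (by positivity)
  set χ := 4 * β / (1 + S) with hχ
  have hroot : χ / (2 * β) + χ ^ 2 * κ ^ 2 = 1 := by
    rw [hχ]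
    field_simp
    linarith [hS2]
  have h1 : (γ + ε) / (2 * β) ≤ χ / (2 * β) := by gcongr; linarith
  have h2 : γ ^ 2 * κ ^ 2 ≤ χ ^ 2 * κ ^ 2 := by gcongr; linarith
  rw [add_div] at h1
  linarith

lemma forwardBackwardHalfForward_step {A : H → Set H} {C D : H → H} {β κ γ δ : ℝ}
    (hβ : 0 < β) (hC : IsCocoercive β C) (hD : IsLipBound κ D) (hγ : 0 < γ)
    (hAD : ∀ x y u v, u ∈ A x → v ∈ A y → 0 ≤ ⟪x - y, (u + D x) - (v + D y)⟫)
    (hδ : γ / (2 * β) + γ ^ 2 * κ ^ 2 + δ ≤ 1) {s z p u : H}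
    (hs : -(C s + D s) ∈ A s) (hu : u ∈ A p) (hp : z - γ • (C z + D z) - p = γ • u) :
    ‖p + γ • (D z - D p) - s‖ ^ 2 + δ * ‖z - p‖ ^ 2 ≤ ‖z - s‖ ^ 2 := by
  have h1 := mul_nonneg hγ.le (hAD p s u _ hu hs)
  have e1 : γ • ((u + D p) - (-(C s + D s) + D s)) =
      (z - p) - γ • (D z - D p) - γ • (C z - C s) := by
    have : γ • ((u + D p) - (-(C s + D s) + D s)) = γ • u + γ • (D p + C s) := by
      rw [← smul_add]; congr 1; abel
    rw [this, ← hp]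
    simp only [smul_add, smul_sub]
    abel
  rw [← real_inner_smul_right, e1, inner_sub_right, inner_sub_right,
    real_inner_smul_right _ (C z - C s)] at h1
  have e2 : ⟪p - s, C z - C s⟫ = ⟪z - s, C z - C s⟫ - ⟪z - p, C z - C s⟫ := by
    rw [← inner_sub_left]; congr 1; abel
  have h2 := hC z s
  have h3 := real_inner_le_norm (z - p) (C z - C s)
  have h4 : ‖γ • (D z - D p)‖ ^ 2 ≤ γ ^ 2 * κ ^ 2 * ‖z - p‖ ^ 2 := by
    rw [norm_smul, Real.norm_of_nonneg hγ.le, mul_pow, mul_assoc, ← mul_pow κ]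
    gcongr
    exact hD z p
  have e3 : ‖p + γ • (D z - D p) - s‖ ^ 2 =
      ‖p - s‖ ^ 2 + 2 * ⟪p - s, γ • (D z - D p)⟫ + ‖γ • (D z - D p)‖ ^ 2 := by
    rw [← norm_add_sq_real]; congr 2; abel
  have e4 : ‖z - s‖ ^ 2 = ‖p - s‖ ^ 2 + 2 * ⟪p - s, z - p⟫ + ‖z - p‖ ^ 2 := by
    rw [← norm_add_sq_real]; congr 2; abel
  have h5 : 2 * (‖z - p‖ * ‖C z - C s‖) - 2 * β * ‖C z - C s‖ ^ 2 ≤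
      1 / (2 * β) * ‖z - p‖ ^ 2 := by
    have : 1 / (2 * β) * ‖z - p‖ ^ 2 -
        (2 * (‖z - p‖ * ‖C z - C s‖) - 2 * β * ‖C z - C s‖ ^ 2) =
        1 / (2 * β) * (‖z - p‖ - 2 * β * ‖C z - C s‖) ^ 2 := by
      field_simp; ring
    have h0 : 0 ≤ 1 / (2 * β) * (‖z - p‖ - 2 * β * ‖C z - C s‖) ^ 2 := by positivity
    linarith
  have h6 : -(2 * (γ * ⟪p - s, C z - C s⟫)) ≤ γ / (2 * β) * ‖z - p‖ ^ 2 := by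
    calc -(2 * (γ * ⟪p - s, C z - C s⟫))
        = γ * (2 * ⟪z - p, C z - C s⟫ - 2 * ⟪z - s, C z - C s⟫) := by rw [e2]; ring
      _ ≤ γ * (1 / (2 * β) * ‖z - p‖ ^ 2) := by
          refine mul_le_mul_of_nonneg_left ?_ hγ.le; linarith
      _ = _ := by ring
  have h7 := mul_le_mul_of_nonneg_right hδ (sq_nonneg ‖z - p‖)
  rw [e3, e4]
  nlinarith

lemma IsMonotoneSV.resolvent_lipschitz {ρ γ : ℝ} (hγ : 0 ≤ γ) {A : H → Set H}
    (hA : IsMonotoneSV ρ A) {a b p q : H} (hp : a - p ∈ γ • A p) (hq : b - q ∈ γ • A q) :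
    (1 + γ * ρ) * ‖p - q‖ ≤ ‖a - b‖ := by
  obtain ⟨u, hu, hu'⟩ := hp
  obtain ⟨v, hv, hv'⟩ := hq
  simp only at hu' hv'
  have h1 := mul_le_mul_of_nonneg_left (hA p q u v hu hv) hγ
  have e : γ • (u - v) = (a - b) - (p - q) := by
    rw [smul_sub, hu', hv']; abel
  rw [← real_inner_smul_right, e, inner_sub_right, real_inner_self_eq_norm_sq] at h1
  have h2 := real_inner_le_norm (p - q) (a - b)
  rcases (norm_nonneg (p - q)).eq_or_lt with h | h
  · rw [← h]; simp
  · refine le_of_mul_le_mul_right ?_ h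
    nlinarith

lemma exists_add_smul_eq [CompleteSpace H] {ρ l X : ℝ} (hl : 0 ≤ l) (hX : 0 < X)
    {A : H → Set H} (hA : IsMonotoneSV ρ A) {E : H → H} (hE : IsLipBound l E) {J : ℝ → H → H}
    (hJ : ∀ γ : ℝ, 0 < γ → γ < X → ∀ x y : H, J γ x = y ↔ x - y ∈ γ • A y) :
    ∃ γ : ℝ, 0 < γ ∧ ∀ y : H, ∃ a, ∃ b ∈ A a, y = a + γ • (b + E a) := by
  set m := 4 * (l + |ρ| + 1) with hm
  have hm0 : 0 < m := by positivity
  set γ := min (X / 2) (1 / m) with hγdef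
  have hγ : 0 < γ := by positivity
  have hγX : γ < X := (min_le_left _ _).trans_lt (by linarith)
  have hγm : γ * m ≤ 1 := by
    rw [← le_div_iff₀ hm0]; exact min_le_right _ _
  have hγl : γ * l ≤ 1 / 4 := by nlinarith [mul_nonneg hγ.le (abs_nonneg ρ)]
  have hγρ : 3 / 4 ≤ 1 + γ * ρ := by
    nlinarith [mul_le_mul_of_nonneg_left (neg_abs_le ρ) hγ.le, mul_nonneg hγ.le hl]
  refine ⟨γ, hγ, fun y => ?_⟩
  have hcontr : ContractingWith (1 / 2) (fun a => J γ (y - γ • E a)) := by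
    refine ⟨by rw [← NNReal.coe_lt_coe]; norm_num, LipschitzWith.of_dist_le_mul fun a b => ?_⟩
    rw [dist_eq_norm, dist_eq_norm]
    have h1 := hA.resolvent_lipschitz hγ.le ((hJ γ hγ hγX (y - γ • E a) _).mp rfl)
      ((hJ γ hγ hγX (y - γ • E b) _).mp rfl)
    have h2 : ‖y - γ • E a - (y - γ • E b)‖ ≤ 1 / 4 * ‖a - b‖ := by
      have : y - γ • E a - (y - γ • E b) = -(γ • (E a - E b)) := by
        rw [smul_sub]; abel
      rw [this, norm_neg, norm_smul, Real.norm_of_nonneg hγ.le]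
      nlinarith [mul_le_mul_of_nonneg_left (hE a b) hγ.le,
        mul_le_mul_of_nonneg_right hγl (norm_nonneg (a - b))]
    have h3 := mul_le_mul_of_nonneg_right hγρ
      (norm_nonneg (J γ (y - γ • E a) - J γ (y - γ • E b)))
    push_cast
    nlinarith [norm_nonneg (a - b)]
  obtain ⟨a, ha⟩ : ∃ a, J γ (y - γ • E a) = a := ⟨_, hcontr.fixedPoint_isFixedPt⟩
  obtain ⟨b, hb, hb'⟩ := (hJ γ hγ hγX _ _).mp ha
  simp only at hb'
  refine ⟨a, b, hb, ?_⟩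
  rw [smul_add, hb']
  abel

lemma exists_ultrafilter_weak_limit [CompleteSpace H] (U : Ultrafilter ℕ) {z : ℕ → H} {R : ℝ}
    (hz : ∀ n, ‖z n‖ ≤ R) : ∃ y : H, ∀ w : H, Tendsto (fun n => ⟪z n, w⟫) U (𝓝 ⟪y, w⟫) := by
  let f : ℕ → WeakDual ℝ H := fun n => StrongDual.toWeakDual (InnerProductSpace.toDual ℝ H (z n))
  have hK := WeakDual.isCompact_closedBall (𝕜 := ℝ) (E := H) 0 R
  obtain ⟨g, -, hg⟩ := hK.ultrafilter_le_nhds (U.map f) (by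
    rw [le_principal_iff]
    refine Filter.mem_map.mpr (Filter.univ_mem' fun n => ?_)
    change WeakDual.toStrongDual (f n) ∈ Metric.closedBall _ _
    rw [mem_closedBall_zero_iff]
    change ‖InnerProductSpace.toDual ℝ H (z n)‖ ≤ R
    simpa using hz n)
  refine ⟨(InnerProductSpace.toDual ℝ H).symm (WeakDual.toStrongDual g), fun w => ?_⟩
  rw [InnerProductSpace.toDual_symm_apply]
  exact ((WeakDual.eval_continuous w).tendsto g).comp hg

/-- Opial's lemma, formulated with ultrafilters. -/
lemma exists_weak_limit_of_opial [CompleteSpace H] {Z : Set H} {z : ℕ → H} (hne : Z.Nonempty)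
    (hconv : ∀ s ∈ Z, ∃ l, Tendsto (fun n => ‖z n - s‖) atTop (𝓝 l))
    (hcl : ∀ U : Ultrafilter ℕ, (U : Filter ℕ) ≤ atTop → ∀ y : H,
      (∀ w : H, Tendsto (fun n => ⟪z n, w⟫) U (𝓝 ⟪y, w⟫)) → y ∈ Z) :
    ∃ y ∈ Z, ∀ w : H, Tendsto (fun n => ⟪z n, w⟫) atTop (𝓝 ⟪y, w⟫) := by
  obtain ⟨s, hs⟩ := hne
  obtain ⟨R, hR⟩ : ∃ R, ∀ n, ‖z n‖ ≤ R := by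
    obtain ⟨l, hl⟩ := hconv s hs
    obtain ⟨R, hR⟩ := hl.bddAbove_range
    refine ⟨R + ‖s‖, fun n => ?_⟩
    have h1 : ‖z n - s‖ ≤ R := hR ⟨n, rfl⟩
    linarith [norm_le_norm_add_norm_sub' (z n) s]
  have hlim := fun U : Ultrafilter ℕ => exists_ultrafilter_weak_limit U hR
  choose y hy using hlim
  have hyZ : ∀ U : Ultrafilter ℕ, (U : Filter ℕ) ≤ atTop → y U ∈ Z := fun U hU =>
    hcl U hU _ (hy U)
  have huniq : ∀ U V : Ultrafilter ℕ, (U : Filter ℕ) ≤ atTop → (V : Filter ℕ) ≤ atTop →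
      y U = y V := by
    intro U V hU hV
    obtain ⟨l, hl⟩ := hconv _ (hyZ U hU)
    obtain ⟨m, hm⟩ := hconv _ (hyZ V hV)
    have hd : Tendsto (fun n => ⟪z n, y U - y V⟫) atTop
        (𝓝 ((m ^ 2 - l ^ 2 + ‖y U‖ ^ 2 - ‖y V‖ ^ 2) / 2)) := by
      have := ((((hm.pow 2).sub (hl.pow 2)).add_const (‖y U‖ ^ 2)).sub_const
        (‖y V‖ ^ 2)).div_const 2
      refine this.congr fun n => ?_
      rw [norm_sub_sq_real, norm_sub_sq_real, inner_sub_right]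
      ring
    have h1 := tendsto_nhds_unique (hy U (y U - y V)) (hd.mono_left hU)
    have h2 := tendsto_nhds_unique (hy V (y U - y V)) (hd.mono_left hV)
    have h3 : ⟪y U - y V, y U - y V⟫ = 0 := by rw [inner_sub_left, h1, h2, sub_self]
    exact sub_eq_zero.mp (inner_self_eq_zero.mp h3)
  obtain ⟨U₀, hU₀⟩ := Ultrafilter.exists_le (atTop : Filter ℕ)
  refine ⟨y U₀, hyZ U₀ hU₀, fun w => ?_⟩
  rw [tendsto_iff_ultrafilter]
  intro U hU
  rw [huniq U₀ U hU₀ hU]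
  exact hy U w

lemma tendsto_of_quasiFejer {s ω : ℕ → ℝ} (hs : ∀ n, 0 ≤ s n) (hω : ∀ n, 0 ≤ ω n)
    (hsum : Summable ω) (hrec : ∀ n, s (n + 1) ≤ s n + ω n * (1 + s n)) :
    ∃ l, Tendsto s atTop (𝓝 l) := by
  have hb : ∀ n, 1 + s n ≤ (1 + s 0) * Real.exp (∑ k ∈ Finset.range n, ω k) := by
    intro n
    induction n with
    | zero => simp
    | succ n ih =>
      rw [Finset.sum_range_succ, Real.exp_add, ← mul_assoc]
      calc 1 + s (n + 1) ≤ (1 + s n) * (1 + ω n) := by linarith [hrec n]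
        _ ≤ _ := by
          have := hω n
          refine mul_le_mul ih ?_ (by linarith) ((add_nonneg zero_le_one (hs n)).trans ih)
          linarith [Real.add_one_le_exp (ω n)]
  set S := (1 + s 0) * Real.exp (∑' k, ω k) with hSdef
  have hS : ∀ n, 1 + s n ≤ S := fun n => (hb n).trans (by
    have := hs 0
    have := hsum.sum_le_tsum (Finset.range n) (fun k _ => hω k)
    rw [hSdef]
    gcongr)
  have hsum' : Summable fun n => ω n * S := hsum.mul_right S
  have hanti : Antitone fun n => s n - ∑ k ∈ Finset.range n, ω k * S := by
    refine antitone_nat_of_succ_le fun n => ?_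
    rw [Finset.sum_range_succ]
    linarith [hrec n, mul_le_mul_of_nonneg_left (hS n) (hω n)]
  have hS0 : 0 ≤ S := by linarith [hs 0, hS 0]
  have hbdd : BddBelow (Set.range fun n => s n - ∑ k ∈ Finset.range n, ω k * S) := by
    refine ⟨-∑' k, ω k * S, ?_⟩
    rintro _ ⟨n, rfl⟩
    have := hsum'.sum_le_tsum (Finset.range n) (fun k _ => mul_nonneg (hω k) hS0)
    have := hs n
    simp only
    linarith
  refine ⟨_, ((tendsto_atTop_ciInf hanti hbdd).add hsum'.hasSum.tendsto_sum_nat).congr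
    fun n => ?_⟩
  ring

lemma tendsto_step_of_quasiFejer {s t d ω : ℕ → ℝ} {δ : ℝ} (hδ : 0 < δ) (hs : ∀ n, 0 ≤ s n)
    (hd : ∀ n, 0 ≤ d n) (hω : ∀ n, 0 ≤ ω n) (hsum : Summable ω)
    (hrec : ∀ n, s (n + 1) ≤ t n + ω n * (1 + s n))
    (hstep : ∀ n, t n ^ 2 + δ * d n ^ 2 ≤ s n ^ 2) :
    (∃ l, Tendsto s atTop (𝓝 l)) ∧ Tendsto d atTop (𝓝 0) := by
  have hts : ∀ n, t n ≤ s n := fun n =>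
    le_of_sq_le_sq (by nlinarith [hstep n, sq_nonneg (d n)]) (hs n)
  obtain ⟨l, hl⟩ := tendsto_of_quasiFejer hs hω hsum fun n => (hrec n).trans (by linarith [hts n])
  refine ⟨⟨l, hl⟩, ?_⟩
  have hlow : Tendsto (fun n => s (n + 1) - ω n * (1 + s n)) atTop (𝓝 l) := by
    have := ((tendsto_add_atTop_iff_nat 1).mpr hl).sub
      (hsum.tendsto_atTop_zero.mul (hl.const_add 1))
    simpa using this
  have htl : Tendsto t atTop (𝓝 l) :=
    tendsto_of_tendsto_of_tendsto_of_le_of_le hlow hl (fun n => by simp only; linarith [hrec n]) hts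
  have hsq : Tendsto (fun n => (s n ^ 2 - t n ^ 2) / δ) atTop (𝓝 0) := by
    simpa using ((hl.pow 2).sub (htl.pow 2)).div_const δ
  have hroot : Tendsto (fun n => Real.sqrt ((s n ^ 2 - t n ^ 2) / δ)) atTop (𝓝 0) := by
    simpa using hsq.sqrt
  refine squeeze_zero hd (fun n => ?_) hroot
  refine Real.le_sqrt_of_sq_le ?_
  rw [le_div_iff₀ hδ]
  linarith [hstep n]

/-- Perturbing the forward operator `D` to `D'` in one step moves the result by an amount
controlled by the perturbation size `w`. -/
lemma perturbed_step_le {ρ τ Γ W r l κ : ℝ} (hτ : 0 ≤ τ) (hΓ : 0 ≤ Γ) (hr : 0 ≤ r)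
    (hl : 0 ≤ l) (hκ : 0 ≤ κ) (hW : 0 ≤ W) {A : H → Set H} (hA : IsMonotoneSV ρ A)
    {C D : H → H} (hCD : IsLipBound l fun x => C x + D x) (hD : IsLipBound κ D) {s : H}
    (hs : -(C s + D s) ∈ A s) :
    ∃ M : ℝ, 0 ≤ M ∧ ∀ (D' : H → H) (γ w : ℝ) (z x p : H), 0 < γ → γ ≤ Γ →
      1 ≤ τ * (1 + γ * ρ) → 0 ≤ w → w ≤ W →
      (∀ q, ‖D' q - D q‖ ≤ w * (r * (1 + ‖q - s‖))) →
      z - γ • (C z + D' z) - x ∈ γ • A x → z - γ • (C z + D z) - p ∈ γ • A p →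
      ‖(x + γ • (D' z - D' x)) - (p + γ • (D z - D p))‖ ≤ M * w * (1 + ‖z - s‖) := by
  set d := τ * (Γ * r) with hd
  set e := τ * (1 + Γ * l) with he
  have hd0 : 0 ≤ d := by positivity
  have he0 : 0 ≤ e := by positivity
  refine ⟨d + Γ * r + Γ * (r * (1 + d * W + e) + κ * d), by positivity, ?_⟩
  intro D' γ w z x p hγ hγΓ hτγ hw hwW hD' hx hp
  have hlip : ∀ {a b p q : H}, a - p ∈ γ • A p → b - q ∈ γ • A q →
      ‖p - q‖ ≤ τ * ‖a - b‖ := by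
    intro a b p q h1 h2
    have h3 := mul_le_mul_of_nonneg_left (hA.resolvent_lipschitz hγ.le h1 h2) hτ
    have h4 := mul_le_mul_of_nonneg_right hτγ (norm_nonneg (p - q))
    linarith
  set S := 1 + ‖z - s‖ with hS
  have hS1 : 1 ≤ S := by simp [hS]
  have hzx : ‖D' z - D z‖ ≤ w * (r * S) := hD' z
  have hxp : ‖x - p‖ ≤ d * w * S := by
    refine (hlip hx hp).trans ?_
    have : z - γ • (C z + D' z) - (z - γ • (C z + D z)) = -(γ • (D' z - D z)) := by
      simp only [smul_add, smul_sub]; abel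
    rw [this, norm_neg, norm_smul, Real.norm_of_nonneg hγ.le]
    calc τ * (γ * ‖D' z - D z‖) ≤ τ * (Γ * (w * (r * S))) := by gcongr
      _ = d * w * S := by rw [hd]; ring
  have hps : ‖p - s‖ ≤ e * ‖z - s‖ := by
    have hs' : s - γ • (C s + D s) - s ∈ γ • A s := by
      refine ⟨_, hs, ?_⟩
      simp only [smul_neg]; abel
    refine (hlip hp hs').trans ?_
    have : z - γ • (C z + D z) - (s - γ • (C s + D s)) =
        (z - s) - γ • ((C z + D z) - (C s + D s)) := by
      rw [smul_sub]; abel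
    rw [this, he, mul_assoc]
    refine mul_le_mul_of_nonneg_left ?_ hτ
    refine (norm_sub_le _ _).trans ?_
    rw [norm_smul, Real.norm_of_nonneg hγ.le]
    have h1 : ‖C z + D z - (C s + D s)‖ ≤ l * ‖z - s‖ := hCD z s
    calc ‖z - s‖ + γ * ‖C z + D z - (C s + D s)‖ ≤ ‖z - s‖ + Γ * (l * ‖z - s‖) := by gcongr
      _ = _ := by ring
  have hxs : 1 + ‖x - s‖ ≤ (1 + d * W + e) * S := by
    have h1 : ‖x - s‖ ≤ ‖x - p‖ + ‖p - s‖ := norm_sub_le_norm_sub_add_norm_sub x p s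
    have h2 : d * w * S ≤ d * W * S := by gcongr
    have h3 : e * ‖z - s‖ ≤ e * S := by gcongr; simp [hS]
    nlinarith
  have hDx : ‖D' x - D p‖ ≤ w * (r * ((1 + d * W + e) * S)) + κ * (d * w * S) := by
    have h1 : ‖D' x - D p‖ ≤ ‖D' x - D x‖ + ‖D x - D p‖ :=
      norm_sub_le_norm_sub_add_norm_sub _ _ _
    have h2 : w * (r * (1 + ‖x - s‖)) ≤ w * (r * ((1 + d * W + e) * S)) := by gcongr
    have h3 : κ * ‖x - p‖ ≤ κ * (d * w * S) := by gcongr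
    linarith [hD' x, hD x p]
  have hsplit : (x + γ • (D' z - D' x)) - (p + γ • (D z - D p)) =
      (x - p) + γ • ((D' z - D z) - (D' x - D p)) := by
    simp only [smul_sub]; abel
  rw [hsplit]
  refine (norm_add_le _ _).trans ?_
  rw [norm_smul, Real.norm_of_nonneg hγ.le]
  calc ‖x - p‖ + γ * ‖(D' z - D z) - (D' x - D p)‖
      ≤ d * w * S + Γ * (w * (r * S) +
          (w * (r * ((1 + d * W + e) * S)) + κ * (d * w * S))) := by
        gcongr
        exact (norm_sub_le _ _).trans (add_le_add hzx hDx)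
    _ = _ := by ring

/-- The graph of `A + E` is sequentially closed at `0` for weak-strong convergence. -/
lemma zero_mem_of_weak_limit {U : Filter ℕ} [U.NeBot] {A : H → Set H} {E : H → H}
    (hAE : ∀ x y u v, u ∈ A x → v ∈ A y → 0 ≤ ⟪x - y, (u + E x) - (v + E y)⟫)
    {γ : ℝ} (hγ : 0 < γ) (hsurj : ∀ y : H, ∃ a, ∃ b ∈ A a, y = a + γ • (b + E a))
    {p u : ℕ → H} {R : ℝ} (hp : ∀ n, ‖p n‖ ≤ R) (hu : ∀ n, u n ∈ A (p n))
    (hv : Tendsto (fun n => u n + E (p n)) U (𝓝 0)) {y : H}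
    (hy : ∀ w : H, Tendsto (fun n => ⟪p n, w⟫) U (𝓝 ⟪y, w⟫)) : -E y ∈ A y := by
  obtain ⟨a, b, hb, hab⟩ := hsurj y
  set v := b + E a with hvdef
  have h0 : Tendsto (fun n => ⟪p n, u n + E (p n)⟫) U (𝓝 0) := by
    refine squeeze_zero_norm (a := fun n => R * ‖u n + E (p n)‖) (fun n => ?_) ?_
    · refine (norm_inner_le_norm _ _).trans ?_
      gcongr
      exact hp n
    · simpa using hv.norm.const_mul R
  have h1 : Tendsto (fun n => ⟪p n - a, (u n + E (p n)) - v⟫) U (𝓝 (-⟪y - a, v⟫)) := by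
    have h2 : Tendsto (fun n => ⟪a, u n + E (p n)⟫) U (𝓝 0) := by
      simpa using (tendsto_const_nhds (x := a)).inner hv
    have h3 := ((h0.sub h2).sub (hy v)).add_const ⟪a, v⟫
    have e : (0 : ℝ) - 0 - ⟪y, v⟫ + ⟪a, v⟫ = -⟪y - a, v⟫ := by
      rw [inner_sub_left]; ring
    rw [e] at h3
    refine h3.congr fun n => ?_
    simp only [inner_sub_left, inner_sub_right]
    ring
  have h2 : 0 ≤ -⟪y - a, v⟫ :=
    ge_of_tendsto h1 (Eventually.of_forall fun n => hAE _ _ _ _ (hu n) hb)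
  have h3 : y - a = γ • v := by rw [hab]; abel
  rw [h3, real_inner_smul_left, real_inner_self_eq_norm_sq] at h2
  have h4 : v = 0 := by
    by_contra hne
    have : 0 < ‖v‖ ^ 2 := by have := norm_pos_iff.mpr hne; positivity
    nlinarith
  rw [h4, smul_zero, sub_eq_zero] at h3
  rw [h3, ← eq_neg_of_add_eq_zero_left h4]
  exact hb

lemma zero_mem_image_add_iff {H : Type*} [AddCommGroup H] {S : Set H} {c d : H} :
    (0 : H) ∈ (fun u => u + c + d) '' S ↔ -(c + d) ∈ S := by
  constructor
  · rintro ⟨u, hu, h⟩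
    simp only [add_assoc] at h
    rwa [← eq_neg_of_add_eq_zero_left h]
  · intro h
    exact ⟨_, h, by simp only; abel⟩

end Auxiliary

theorem statement12 {H G : Type*} [NormedAddCommGroup H] [InnerProductSpace ℝ H] [CompleteSpace H]
    [NormedAddCommGroup G] [InnerProductSpace ℝ G] [CompleteSpace G]
    (ρ β ζ α : ℝ) (A : H → Set H) (C : H → H) (B : G → G)
    (L : H →L[ℝ] G) (K : G →L[ℝ] H) (c : G)
    (hA : IsMaxMonotoneSV ρ A)
    (hβ : 0 < β) (hC : IsCocoercive β C)
    (hζ : 0 < ζ) (hBmono : IsMonotoneMap B) (hBlip : IsLipBound ζ B)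
    (hα : 0 ≤ α)
    (ζt : ℝ)
    (hζt : IsLipConst ζt (fun x : H => (ContinuousLinearMap.adjoint L - K) (B (L x))))
    (κ : ℝ) (hκ : IsLipConst κ (fun x : H => K (α • L x + B (L x))))
    (hρhat : 0 ≤ (ρ + α * lambdaMin L K - ζt))
    (hDK : ∃ x : H, Dop α L c B K x ≠ 0)
    (Kn : ℕ → G →L[ℝ] H) (ω : ℕ → ℝ) (hωnn : ∀ n, 0 ≤ ω n)
    (hωsum : Summable ω) (hKn : ∀ n, ‖Kn n - K‖ ≤ ω n)
    (hsol : ∃ x : H, ((0:H) ∈ (fun u => u + C x + Dop α L c B K x) '' A x))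
    (ε : ℝ) (hε0 : 0 < ε) (hεχ : ε < chiConst β ρ κ / 2)
    (γ : ℕ → ℝ) (hγ1 : ∀ n, ε ≤ γ n) (hγ2 : ∀ n, γ n ≤ chiConst β ρ κ - ε)
    (J : ℝ → H → H)
    (hJ : ∀ γ' : ℝ, 0 < γ' → γ' < chiConst β ρ κ → ∀ x y : H, J γ' x = y ↔ x - y ∈ γ' • A y)
    (z x : ℕ → H)
    (hx : ∀ n, x n = J (γ n) (z n - γ n • (C (z n) + Dop α L c B (Kn n) (z n))))
    (hzrec : ∀ n, z (n + 1) =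
      x n + γ n • (Dop α L c B (Kn n) (z n) - Dop α L c B (Kn n) (x n))) :
    ∃ zb : H, ((0:H) ∈ (fun u => u + C zb + Dop α L c B K zb) '' A zb) ∧
      ∀ w : H, Tendsto (fun n => ⟪z n, w⟫) atTop (𝓝 ⟪zb, w⟫) := by
  have hκ0 : 0 ≤ κ := by
    obtain ⟨v, hv⟩ : ∃ v : H, v ≠ 0 := hDK.imp' (Dop α L c B K) fun _ => id
    have h1 := (norm_nonneg _).trans (hκ.1 v 0)
    rw [sub_zero] at h1
    exact nonneg_of_mul_nonneg_left h1 (norm_pos_iff.mpr hv)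
  set D := Dop α L c B K with hDdef
  set X := chiConst β ρ κ with hX
  have hXpos : 0 < X := by linarith
  have hXle : X ≤ 4 * β / (1 + Real.sqrt (1 + 16 * β ^ 2 * κ ^ 2)) := by
    rw [hX, chiConst]
    split_ifs
    · exact le_rfl
    · exact min_le_left _ _
  have hγpos : ∀ n, 0 < γ n := fun n => hε0.trans_le (hγ1 n)
  have hγX : ∀ n, γ n < X := fun n => (hγ2 n).trans_lt (by linarith)
  have hDlip : IsLipBound κ D := Dop_isLipBound L c B K hκ.1
  have hClip : IsLipBound (1 / β) C := hC.norm_sub_le hβ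
  have hCDlip : IsLipBound (1 / β + κ) fun x => C x + D x := fun a b => by
    have e : C a + D a - (C b + D b) = (C a - C b) + (D a - D b) := by abel
    simp only [e]
    linarith [norm_add_le (C a - C b) (D a - D b), hClip a b, hDlip a b]
  have hAD : ∀ x y u v, u ∈ A x → v ∈ A y → 0 ≤ ⟪x - y, (u + D x) - (v + D y)⟫ := by
    intro x y u v hu hv
    have h1 := hA.1 x y u v hu hv
    have h2 := Dop_monotone hα L c hBmono K hζt.1 x y
    have h3 := mul_nonneg hρhat (sq_nonneg ‖x - y‖)
    have e : (u + D x) - (v + D y) = (u - v) + (D x - D y) := by abel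
    rw [e, inner_add_right]
    linarith
  have hAE : ∀ x y u v, u ∈ A x → v ∈ A y →
      0 ≤ ⟪x - y, (u + (C x + D x)) - (v + (C y + D y))⟫ := by
    intro x y u v hu hv
    have h1 := hAD x y u v hu hv
    have h2 := (mul_nonneg hβ.le (sq_nonneg ‖C x - C y‖)).trans (hC x y)
    have e : (u + (C x + D x)) - (v + (C y + D y)) =
      ((u + D x) - (v + D y)) + (C x - C y) := by abel
    rw [e, inner_add_right]
    linarith
  obtain ⟨τ, hτ0, hτ⟩ : ∃ τ : ℝ, 0 ≤ τ ∧ ∀ n, 1 ≤ τ * (1 + γ n * ρ) := by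
    by_cases hρ : 0 ≤ ρ
    · refine ⟨1, zero_le_one, fun n => ?_⟩
      linarith [mul_nonneg (hγpos n).le hρ]
    · rw [not_le] at hρ
      have hερ : 0 < ε * -ρ := mul_pos hε0 (neg_pos.mpr hρ)
      refine ⟨1 / (ε * -ρ), by positivity, fun n => ?_⟩
      have h1 : X ≤ -1 / ρ := by
        rw [hX, chiConst, if_neg (not_le.mpr hρ)]
        exact min_le_right _ _
      have h2 : (-1 / ρ - ε) * ρ ≤ γ n * ρ :=
        mul_le_mul_of_nonpos_right ((hγ2 n).trans (by linarith)) hρ.le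
      have h3 : (-1 / ρ - ε) * ρ = -1 + ε * -ρ := by
        rw [sub_mul, div_mul_cancel₀ _ hρ.ne]
        ring
      rw [one_div, inv_mul_eq_div, le_div_iff₀ hερ]
      linarith
  have hxA : ∀ n, z n - γ n • (C (z n) + Dop α L c B (Kn n) (z n)) - x n ∈ γ n • A (x n) :=
    fun n => (hJ _ (hγpos n) (hγX n) _ _).mp (hx n).symm
  set p : ℕ → H := fun n => J (γ n) (z n - γ n • (C (z n) + D (z n))) with hpdef
  have hpA : ∀ n, z n - γ n • (C (z n) + D (z n)) - p n ∈ γ n • A (p n) :=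
    fun n => (hJ _ (hγpos n) (hγX n) _ _).mp rfl
  have hWω : ∀ n, ω n ≤ ∑' k, ω k := fun n => hωsum.le_tsum n fun k _ => hωnn k
  have key : ∀ s : H, -(C s + D s) ∈ A s →
      (∃ l, Tendsto (fun n => ‖z n - s‖) atTop (𝓝 l)) ∧
        Tendsto (fun n => ‖z n - p n‖) atTop (𝓝 0) := by
    intro s hs
    obtain ⟨r, hr, hpert⟩ := Dop_perturbation hα hζ.le L c hBlip K s
    obtain ⟨M, hM, hstep⟩ := perturbed_step_le (W := ∑' k, ω k) hτ0 hXpos.le hr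
      (by positivity) hκ0 (tsum_nonneg hωnn) hA.1 hCDlip hDlip hs
    refine tendsto_step_of_quasiFejer (δ := ε / (2 * β)) (ω := fun n => M * ω n)
      (t := fun n => ‖p n + γ n • (D (z n) - D (p n)) - s‖) (by positivity)
      (fun n => norm_nonneg _) (fun n => norm_nonneg _)
      (fun n => mul_nonneg hM (hωnn n)) (hωsum.mul_left M) (fun n => ?_) (fun n => ?_)
    · have h1 := hstep (Dop α L c B (Kn n)) (γ n) (ω n) (z n) (x n) (p n) (hγpos n)
        (hγX n).le (hτ n) (hωnn n) (hWω n)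
        (fun q => (hpert (Kn n) q).trans (by gcongr; exact hKn n)) (hxA n) (hpA n)
      rw [← hzrec n] at h1
      have h2 := norm_sub_le_norm_sub_add_norm_sub (z (n + 1))
        (p n + γ n • (D (z n) - D (p n))) s
      linarith
    · obtain ⟨u, hu, hu'⟩ := hpA n
      exact forwardBackwardHalfForward_step hβ hC hDlip (hγpos n) hAD
        (step_bound hβ hε0.le (hγpos n).le (by linarith [hγ2 n])) hs hu hu'.symm
  obtain ⟨s₀, hs₀⟩ := hsol
  rw [zero_mem_image_add_iff] at hs₀
  obtain ⟨⟨l₀, hl₀⟩, hzp⟩ := key s₀ hs₀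
  obtain ⟨R, hR⟩ : ∃ R, ∀ n, ‖p n‖ ≤ R := by
    obtain ⟨R₁, hR₁⟩ := hl₀.bddAbove_range
    obtain ⟨R₂, hR₂⟩ := hzp.bddAbove_range
    refine ⟨R₁ + R₂ + ‖s₀‖, fun n => ?_⟩
    have h1 : ‖z n - s₀‖ ≤ R₁ := hR₁ ⟨n, rfl⟩
    have h2 : ‖z n - p n‖ ≤ R₂ := hR₂ ⟨n, rfl⟩
    have e : p n = (z n - s₀) - (z n - p n) + s₀ := by abel
    rw [e]
    linarith [norm_add_le ((z n - s₀) - (z n - p n)) s₀, norm_sub_le (z n - s₀) (z n - p n)]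
  choose u hu hu' using hpA
  simp only at hu'
  have hres : Tendsto (fun n => u n + (C (p n) + D (p n))) atTop (𝓝 0) := by
    refine squeeze_zero_norm (a := fun n => (1 / ε + (1 / β + κ)) * ‖z n - p n‖)
      (fun n => ?_) (by simpa using hzp.const_mul (1 / ε + (1 / β + κ)))
    have e : u n + (C (p n) + D (p n)) = (γ n)⁻¹ • (z n - p n) -
        ((C (z n) + D (z n)) - (C (p n) + D (p n))) := by
      have h1 : u n = (γ n)⁻¹ • (z n - γ n • (C (z n) + D (z n)) - p n) := by
        rw [← hu' n, inv_smul_smul₀ (hγpos n).ne']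
      rw [h1, sub_right_comm, smul_sub _ (z n - p n), inv_smul_smul₀ (hγpos n).ne']
      abel
    rw [e]
    refine (norm_sub_le _ _).trans ?_
    rw [add_mul]
    refine add_le_add ?_ (hCDlip _ _)
    rw [norm_smul, norm_inv, Real.norm_of_nonneg (hγpos n).le, one_div]
    gcongr
    exact hγ1 n
  obtain ⟨g, hg, hsurj⟩ := exists_add_smul_eq (by positivity) hXpos hA.1 hCDlip hJ
  obtain ⟨y, hy, hlim⟩ := exists_weak_limit_of_opial (Z := {s | -(C s + D s) ∈ A s}) (z := z)
    ⟨s₀, hs₀⟩ (fun s hs => (key s hs).1) (fun U hU y hy => by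
      refine zero_mem_of_weak_limit (E := fun x => C x + D x) hAE hg hsurj hR hu
        (hres.mono_left hU) (fun w => ?_)
      have h1 : Tendsto (fun n => ⟪z n - p n, w⟫) U (𝓝 0) := by
        simpa using ((tendsto_zero_iff_norm_tendsto_zero.mpr hzp).mono_left hU).inner
          (tendsto_const_nhds (x := w))
      refine (by simpa using (hy w).sub h1 : Tendsto (fun n => ⟪z n, w⟫ - ⟪z n - p n, w⟫) U
        (𝓝 ⟪y, w⟫)).congr fun n => ?_
      rw [inner_sub_left]
      ring)
  exact ⟨y, zero_mem_image_add_iff.mpr hy, hlim⟩
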